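/- Let m ≥ 1 be an integer and let f_0, f_1, …, f_{m−2} be real numbers. Let M be the m×m real matrix whose entries (indexed by 0 ≤ i, j ≤ m−1) are M_{i,j} = f_j + 1 if j ≤ m−2 and i ≤ j, M_{i,j} = f_j if j ≤ m−2 and i > j, and M_{i,m−1} = 1 for every i. Then det M = 1. (Consequently the m-dimensional map equivalent to a long term memory map with integer power-law memory is volume preserving.) -/

import Mathlib

open Matrix

theorem stmt15 (m : ℕ) (hm : 1 ≤ m) (f : ℕ → ℝ) :
    Matrix.det (Matrix.of (fun i j : Fin m =>
      if (j : ℕ) + 1 < m then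
        (if (i : ℕ) ≤ (j : ℕ) then f j + 1 else f j)
      else 1)) = 1 := by
  let U : Matrix (Fin m) (Fin m) ℝ := Matrix.of fun i j => if (i : ℕ) ≤ j then 1 else 0
  have hU : U.det = 1 := by
    rw [Matrix.det_of_isUpperTriangular]
    · simp [U]
    · intro i j hij
      have h : ¬ (i : ℕ) ≤ j := Nat.not_le.mpr hij
      simp only [U, Matrix.of_apply, if_neg h]
  refine Eq.trans ?_ hU
  rw [← Matrix.det_transpose, ← Matrix.det_transpose U]
  -- Subtracting multiples of the all-ones last column leaves the triangular matrix `U`.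
  refine Matrix.det_eq_of_forall_row_eq_smul_add_const
    (fun j : Fin m => if (j : ℕ) + 1 < m then f j else 0) ⟨m - 1, by omega⟩ ?_ ?_
  · exact if_neg (by simp only; omega)
  · intro j i
    have hi : (i : ℕ) ≤ m - 1 := by omega
    simp only [U, Matrix.transpose_apply, Matrix.of_apply, if_pos hi, mul_one]
    by_cases hj : (j : ℕ) + 1 < m
    · simp only [if_pos hj]
      split_ifs <;> ring
    · have hij : (i : ℕ) ≤ j := by omega
      simp only [if_neg hj, if_pos hij, add_zero]
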